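/- arXiv:1907.10123 — 2 statements merged into one kernel-verified Lean document; each statement's English description precedes it below -/
import Mathlib

section
/- Fix n ≥ 1 and k ∈ {1,…,n}, and let Ĥ_{n,k} = {f = (τ_1,…,τ_n) ∈ F_n : τ_k = (0 n)}. Define φ_k(τ_1,…,τ_n) = (τ̄_{k+1},…,τ̄_n, τ_1,…,τ_{k−1}), where for a transposition τ = (a b) with 1 ≤ a < b the transposition τ̄ is (a−1, b−1). Then φ_k is a well-defined bijection from Ĥ_{n,k} onto F_{n−1}, and for every f ∈ Ĥ_{n,k} one has area_L(f) = area_L(φ_k(f)) + k − 1 and area_U(f) = area_U(φ_k(f)) + n − k + 1. -/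
open Finset

/-- The smaller endpoint of a transposition (as a natural number). -/
def swapLow {m : ℕ} (τ : Equiv.Perm (Fin m)) : ℕ :=
  ((τ.support.image Fin.val).min).getD 0

/-- The larger endpoint of a transposition (as a natural number). -/
def swapHigh {m : ℕ} (τ : Equiv.Perm (Fin m)) : ℕ :=
  ((τ.support.image Fin.val).max).getD 0

/-- Minimal factorizations of the full cycle `σ_n = (0 1 ⋯ n)` into `n` transpositions.
Permutations are multiplied left to right, i.e. `τ₁τ₂⋯τₙ` sends `x` to `τₙ(⋯τ₂(τ₁(x))⋯)`,
which is the product of the reversed list in Mathlib's convention. -/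
def FactSet (n : ℕ) : Set (Fin n → Equiv.Perm (Fin (n+1))) :=
  {f | (∀ i, (f i).IsSwap) ∧ ((List.ofFn f).reverse).prod = finRotate (n+1)}

/-- The lower sequence `L(f) = (a₁, …, aₙ)` of a factorization. -/
def lowerSeq {n : ℕ} (f : Fin n → Equiv.Perm (Fin (n+1))) : Fin n → ℕ :=
  fun i => swapLow (f i)

/-- The upper sequence `U(f) = (b₁, …, bₙ)` of a factorization. -/
def upperSeq {n : ℕ} (f : Fin n → Equiv.Perm (Fin (n+1))) : Fin n → ℕ :=
  fun i => swapHigh (f i)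

/-- The lower area `area_L(f) = C(n,2) - (a₁ + ⋯ + aₙ)`. -/
def areaL {n : ℕ} (f : Fin n → Equiv.Perm (Fin (n+1))) : ℕ :=
  n.choose 2 - ∑ i, swapLow (f i)

/-- The upper area `area_U(f) = (b₁ + ⋯ + bₙ) - C(n,2)`. -/
def areaU {n : ℕ} (f : Fin n → Equiv.Perm (Fin (n+1))) : ℕ :=
  (∑ i, swapHigh (f i)) - n.choose 2

/-- The map `φ_k` sending `(τ₁,…,τₙ)` with `τ_k = (0 n)` to
`(τ̄_{k+1},…,τ̄_n, τ₁,…,τ_{k-1})`, where for a transposition `τ = (a b)` with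
`1 ≤ a < b` we set `τ̄ = (a-1, b-1)`; the result is a sequence of `n-1`
transpositions of `{0,…,n-1}`.  (On the relevant domain all the values taken
modulo `n` are the honest endpoints `a-1, b-1`, resp. `a, b`.) -/
def phiMap (n k : ℕ) (f : Fin n → Equiv.Perm (Fin (n+1))) :
    Fin (n-1) → Equiv.Perm (Fin n) := fun i =>
  have hn : 0 < n := by have := i.isLt; omega
  if h : i.val < n - k then
    Equiv.swap ⟨(swapLow (f ⟨k + i.val, by omega⟩) - 1) % n, Nat.mod_lt _ hn⟩
               ⟨(swapHigh (f ⟨k + i.val, by omega⟩) - 1) % n, Nat.mod_lt _ hn⟩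
  else
    Equiv.swap ⟨(swapLow (f ⟨i.val - (n - k), by have := i.isLt; omega⟩)) % n,
                  Nat.mod_lt _ hn⟩
               ⟨(swapHigh (f ⟨i.val - (n - k), by have := i.isLt; omega⟩)) % n,
                  Nat.mod_lt _ hn⟩

section

open Equiv Equiv.Perm

theorem viaEmbeddingHom_swap {α β : Type*} [DecidableEq α] [DecidableEq β] (ι : α ↪ β) (x y : α) :
    viaEmbeddingHom ι (swap x y) = swap (ι x) (ι y) := by
  ext z
  rw [viaEmbeddingHom_apply]
  by_cases hz : z ∈ Set.range ι
  · obtain ⟨w, rfl⟩ := hz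
    rw [viaEmbedding_apply, ← ι.injective.map_swap]
  · rw [viaEmbedding_apply_of_notMem _ _ _ hz, swap_apply_of_ne_of_ne]
    · rintro rfl; exact hz ⟨x, rfl⟩
    · rintro rfl; exact hz ⟨y, rfl⟩

/-- Permutations of `{0,…,m}` acting on `{0,…,m+1}` and fixing `m+1`. -/
noncomputable def liftCastSucc (m : ℕ) : Perm (Fin (m + 1)) →* Perm (Fin (m + 2)) :=
  viaEmbeddingHom Fin.castSuccEmb

/-- Permutations of `{0,…,m}` acting on `{1,…,m+1}` by shifting labels, and fixing `0`. -/
noncomputable def liftSucc (m : ℕ) : Perm (Fin (m + 1)) →* Perm (Fin (m + 2)) :=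
  viaEmbeddingHom (Fin.succEmb (m + 1))

theorem liftCastSucc_swap {m : ℕ} (x y : Fin (m + 1)) :
    liftCastSucc m (swap x y) = swap x.castSucc y.castSucc :=
  viaEmbeddingHom_swap _ x y

theorem liftSucc_swap {m : ℕ} (x y : Fin (m + 1)) :
    liftSucc m (swap x y) = swap x.succ y.succ :=
  viaEmbeddingHom_swap _ x y

theorem liftCastSucc_castSucc {m : ℕ} (π : Perm (Fin (m + 1))) (x : Fin (m + 1)) :
    liftCastSucc m π x.castSucc = (π x).castSucc :=
  viaEmbedding_apply π Fin.castSuccEmb x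

theorem liftCastSucc_last {m : ℕ} (π : Perm (Fin (m + 1))) :
    liftCastSucc m π (Fin.last (m + 1)) = Fin.last (m + 1) :=
  viaEmbedding_apply_of_notMem π Fin.castSuccEmb _ (by
    rintro ⟨x, hx⟩; exact Fin.castSucc_ne_last x hx)

theorem liftSucc_succ {m : ℕ} (π : Perm (Fin (m + 1))) (x : Fin (m + 1)) :
    liftSucc m π x.succ = (π x).succ :=
  viaEmbedding_apply π (Fin.succEmb (m + 1)) x

theorem liftSucc_zero {m : ℕ} (π : Perm (Fin (m + 1))) : liftSucc m π 0 = 0 :=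
  viaEmbedding_apply_of_notMem π (Fin.succEmb (m + 1)) _ (by
    rintro ⟨x, hx⟩; exact Fin.succ_ne_zero x hx)

theorem finRotate_castSucc {m : ℕ} (x : Fin (m + 1)) :
    finRotate (m + 2) x.castSucc = x.succ := by
  rw [finRotate_apply, Fin.coeSucc_eq_succ]

theorem liftSucc_eq_conj {m : ℕ} (π : Perm (Fin (m + 1))) :
    liftSucc m π = finRotate (m + 2) * liftCastSucc m π * (finRotate (m + 2))⁻¹ := by
  rw [eq_mul_inv_iff_mul_eq]
  ext x : 1
  induction x using Fin.lastCases with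
  | last => simp [Perm.mul_apply, liftCastSucc_last, liftSucc_zero]
  | cast x =>
    rw [Perm.mul_apply, Perm.mul_apply, liftCastSucc_castSucc, finRotate_castSucc,
      finRotate_castSucc, liftSucc_succ]

theorem swap_mul_finRotate (m : ℕ) :
    swap 0 (Fin.last (m + 1)) * finRotate (m + 2) = liftCastSucc m (finRotate (m + 1)) := by
  ext x : 1
  induction x using Fin.lastCases with
  | last => rw [Perm.mul_apply, finRotate_last, swap_apply_left, liftCastSucc_last]
  | cast x =>
    rw [Perm.mul_apply, finRotate_castSucc, liftCastSucc_castSucc]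
    induction x using Fin.lastCases with
    | last => simp
    | cast x =>
      rw [swap_apply_of_ne_of_ne (Fin.succ_ne_zero _) (by simp [Fin.ext_iff]; omega)]
      ext
      rw [Fin.val_castSucc, coe_finRotate_of_ne_last (Fin.castSucc_ne_last x)]
      simp

theorem finRotate_mul_swap (m : ℕ) :
    finRotate (m + 2) * swap 0 (Fin.last (m + 1)) = liftSucc m (finRotate (m + 1)) := by
  rw [liftSucc_eq_conj, ← swap_mul_finRotate]
  group

theorem list_prod_apply_mem {α : Type*} {T : Set α} {l : List (Perm α)}
    (hl : ∀ τ ∈ l, ∀ x ∈ T, τ x ∈ T) : ∀ x ∈ T, l.prod x ∈ T := by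
  induction l with
  | nil => simp
  | cons a l ih =>
    intro x hx
    rw [List.prod_cons, Perm.mul_apply]
    exact hl a (by simp) _ (ih (fun τ hτ => hl τ (by simp [hτ])) x hx)

theorem mem_of_finRotate_closed {m : ℕ} {T : Set (Fin (m + 1))}
    (hT : ∀ x ∈ T, finRotate (m + 1) x ∈ T) {x : Fin (m + 1)} (hx : x ∈ T)
    (y : Fin (m + 1)) : y ∈ T := by
  have hpow : ∀ j : ℕ, ((finRotate (m + 1)) ^ j) x ∈ T := by
    intro j
    induction j with
    | zero => simpa
    | succ j ih => rw [pow_succ', Perm.mul_apply]; exact hT _ ih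
  cases m with
  | zero => rwa [Fin.eq_zero y, ← Fin.eq_zero x]
  | succ m =>
    have hmove : ∀ z, finRotate (m + 2) z ≠ z := fun z => by
      rw [← Perm.mem_support, support_finRotate]; simp
    obtain ⟨j, hj⟩ := (isCycle_finRotate (n := m)).exists_pow_eq (hmove x) (hmove y)
    exact hj ▸ hpow j

/-- If `univ` is the only superset of `S` closed under all the transpositions `t i`, then the
vertices outside `S` can be charged to distinct transpositions moving them. -/
theorem sum_compl_le_sum_of_isSwap {α ι : Type*} [DecidableEq α] [DecidableEq ι] [Fintype α]
    [Fintype ι]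
    {t : ι → Perm α} (ht : ∀ i, (t i).IsSwap) {w : α → ℕ} {W : ι → ℕ}
    (hW : ∀ i x, t i x ≠ x → w x ≤ W i) (S : Finset α)
    (hS : ∀ T : Finset α, S ⊆ T → (∀ i, ∀ x ∈ T, t i x ∈ T) → T = univ) :
    ∑ x ∈ Sᶜ, w x ≤ ∑ i with ¬ (t i).support ⊆ S, W i := by
  induction hc : #Sᶜ generalizing S with
  | zero => rw [Finset.card_eq_zero.1 hc]; simp
  | succ c ih =>
    have hne : S ≠ univ := by rintro rfl; simp at hc
    obtain ⟨i, x, hx, hy⟩ : ∃ i, ∃ x ∈ S, t i x ∉ S := by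
      by_contra! h
      exact hne (hS S subset_rfl h)
    set y := t i x with hy'
    have hxy : x ≠ y := fun h => hy (h ▸ hx)
    have hyi : t i y ≠ y := fun h => hxy ((t i).injective (by rw [← hy', h]))
    have hsupp : (t i).support ⊆ insert y S := by
      obtain ⟨a, b, hab, h⟩ := ht i
      rw [h] at hy' ⊢
      rw [support_swap hab]
      have hx' : x = a ∨ x = b := by
        by_contra! h'
        exact hxy (by rw [hy', swap_apply_of_ne_of_ne h'.1 h'.2])
      rcases hx' with rfl | rfl
      · rw [swap_apply_left] at hy'; subst hy'; grind
      · rw [swap_apply_right] at hy'; subst hy'; grind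
    have hcompl : Sᶜ = insert y (insert y S)ᶜ := by
      rw [Finset.compl_insert, Finset.insert_erase (by simpa using hy)]
    have hrec := ih (insert y S) (fun T hT => hS T ((Finset.subset_insert _ _).trans hT))
      (by
        rw [hcompl, Finset.card_insert_of_notMem (by simp)] at hc
        omega)
    rw [hcompl, Finset.sum_insert (by simp)]
    have hsub : insert i ({j | ¬ (t j).support ⊆ insert y S} : Finset ι) ⊆
        ({j | ¬ (t j).support ⊆ S} : Finset ι) := by
      intro j hj
      rcases Finset.mem_insert.1 hj with rfl | hj
      · simp only [mem_filter, mem_univ, true_and]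
        exact fun h => hy (h (Perm.mem_support.2 hyi))
      · simp only [mem_filter, mem_univ, true_and] at hj ⊢
        exact fun h => hj (h.trans (Finset.subset_insert _ _))
    refine le_trans ?_ (Finset.sum_le_sum_of_subset hsub)
    rw [Finset.sum_insert (by simpa using hsupp)]
    exact add_le_add (hW i y hyi) hrec

theorem apply_zero_of_prod_eq {m : ℕ} {l : List (Perm (Fin (m + 2)))}
    (hl : ∀ τ ∈ l, τ.IsSwap) (hlen : l.length = m)
    (hp : l.prod = liftSucc m (finRotate (m + 1))) : ∀ τ ∈ l, τ 0 = 0 := by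
  intro τ hτ
  by_contra h0
  have key := sum_compl_le_sum_of_isSwap (t := l.get) (fun i => hl _ (l.get_mem i))
    (w := fun _ => 1) (W := fun _ => 1) (fun _ _ _ => le_rfl) {0} (by
      intro T h0T hT
      have hT' : ∀ σ ∈ l, ∀ x ∈ (T : Set (Fin (m + 2))), σ x ∈ (T : Set (Fin (m + 2))) := by
        intro σ hσ x hx
        obtain ⟨i, rfl⟩ := List.get_of_mem hσ
        exact hT i x hx
      have h0T : 0 ∈ T := by simpa using h0T
      obtain ⟨z, hz⟩ := Fin.exists_succ_eq.2 h0
      have hcl := mem_of_finRotate_closed (T := {x | x.succ ∈ T}) (x := z) (by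
        intro x hx
        have := list_prod_apply_mem hT' _ hx
        rwa [hp, liftSucc_succ] at this)
        (by
          change z.succ ∈ T
          rw [hz]
          exact hT' τ hτ 0 h0T)
      ext x
      refine Fin.cases (by simpa) (fun y => ?_) x
      simpa using hcl y)
  have h1 : #(univ.filter fun i => ¬ (l.get i).support ⊆ {0}) ≤ m :=
    (Finset.card_le_univ _).trans (by simp [hlen])
  simp only [Finset.sum_const, Finset.card_compl, Fintype.card_fin, Finset.card_singleton,
    smul_eq_mul, mul_one] at key
  omega

theorem swapLow_swap {m : ℕ} {x y : Fin m} (h : x < y) : swapLow (swap x y) = x := by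
  rw [swapLow, support_swap h.ne]
  have : (({x, y} : Finset (Fin m)).image Fin.val).min = ((x : ℕ) : WithTop ℕ) := by
    rw [Finset.image_insert, Finset.image_singleton, Finset.min_insert, Finset.min_singleton]
    exact min_eq_left (by exact_mod_cast h.le)
  rw [this]; rfl

theorem swapHigh_swap {m : ℕ} {x y : Fin m} (h : x < y) : swapHigh (swap x y) = y := by
  rw [swapHigh, support_swap h.ne]
  have : (({x, y} : Finset (Fin m)).image Fin.val).max = ((y : ℕ) : WithBot ℕ) := by
    rw [Finset.image_insert, Finset.image_singleton, Finset.max_insert, Finset.max_singleton]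
    exact max_eq_right (by exact_mod_cast h.le)
  rw [this]; rfl

theorem exists_lt_swap {m : ℕ} {τ : Perm (Fin m)} (h : τ.IsSwap) :
    ∃ x y, x < y ∧ τ = swap x y := by
  obtain ⟨x, y, hxy, rfl⟩ := h
  rcases hxy.lt_or_gt with h | h
  · exact ⟨x, y, h, rfl⟩
  · exact ⟨y, x, h, swap_comm x y⟩

theorem eq_univ_of_mem_factSet {m : ℕ} {g : Fin m → Perm (Fin (m + 1))} (hg : g ∈ FactSet m)
    {T : Finset (Fin (m + 1))} {x : Fin (m + 1)} (hx : x ∈ T)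
    (hT : ∀ i, ∀ x ∈ T, g i x ∈ T) : T = univ := by
  refine Finset.eq_univ_of_forall fun y => ?_
  refine mem_of_finRotate_closed (T := (T : Set (Fin (m + 1)))) ?_ (x := x) hx y
  rw [← hg.2]
  refine list_prod_apply_mem fun τ hτ => ?_
  obtain ⟨i, rfl⟩ := List.mem_ofFn.1 (List.mem_reverse.1 hτ)
  exact hT i

theorem sum_fin_val (m : ℕ) : ∑ x : Fin (m + 1), (x : ℕ) = (m + 1).choose 2 := by
  rw [Fin.sum_univ_eq_sum_range (fun i => i), Finset.sum_range_id, Nat.choose_two_right]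

theorem choose_two_succ (m : ℕ) : (m + 1).choose 2 = m + m.choose 2 := by
  rw [Nat.choose_succ_succ' m 1, Nat.choose_one_right]

theorem choose_two_succ_add_choose_two (m : ℕ) : (m + 1).choose 2 + m.choose 2 = m * m := by
  induction m with
  | zero => simp
  | succ m ih =>
    rw [choose_two_succ (m + 1)]
    have := choose_two_succ m
    linarith

theorem choose_two_le_sum_swapHigh {m : ℕ} {g : Fin m → Perm (Fin (m + 1))}
    (hg : g ∈ FactSet m) : m.choose 2 ≤ ∑ i, swapHigh (g i) := by
  have key := sum_compl_le_sum_of_isSwap hg.1 (w := fun x => (x : ℕ))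
    (W := fun i => swapHigh (g i)) (by
      intro i x hx
      obtain ⟨a, b, hab, h⟩ := exists_lt_swap (hg.1 i)
      rw [h, swapHigh_swap hab]
      rw [h, swap_apply_ne_self_iff] at hx
      rcases hx.2 with rfl | rfl
      · exact hab.le
      · exact le_rfl) {0}
    (fun T h0 hT => eq_univ_of_mem_factSet hg (by simpa using h0) hT)
  calc m.choose 2 ≤ (m + 1).choose 2 := Nat.choose_le_choose 2 (Nat.le_succ m)
    _ = ∑ x ∈ ({0} : Finset (Fin (m + 1)))ᶜ, (x : ℕ) := by
      rw [← sum_fin_val, ← Finset.sum_compl_add_sum {0}]; simp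
    _ ≤ _ := key
    _ ≤ _ := Finset.sum_le_sum_of_subset (Finset.filter_subset _ _)

theorem sum_swapLow_le_choose_two {m : ℕ} {g : Fin m → Perm (Fin (m + 1))}
    (hg : g ∈ FactSet m) : ∑ i, swapLow (g i) ≤ m.choose 2 := by
  have hlow : ∀ i, swapLow (g i) ≤ m := by
    intro i
    obtain ⟨a, b, hab, h⟩ := exists_lt_swap (hg.1 i)
    rw [h, swapLow_swap hab]
    exact Fin.is_le a
  have key := sum_compl_le_sum_of_isSwap hg.1 (w := fun x => m - (x : ℕ))
    (W := fun i => m - swapLow (g i)) (by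
      intro i x hx
      obtain ⟨a, b, hab, h⟩ := exists_lt_swap (hg.1 i)
      rw [h, swapLow_swap hab]
      rw [h, swap_apply_ne_self_iff] at hx
      have : (a : ℕ) < b := hab
      rcases hx.2 with rfl | rfl <;> omega) {Fin.last m}
    (fun T h0 hT => eq_univ_of_mem_factSet hg (by simpa using h0) hT)
  have hw : ∑ x ∈ ({Fin.last m} : Finset (Fin (m + 1)))ᶜ, (m - (x : ℕ)) = (m + 1).choose 2 := by
    rw [← sum_fin_val, ← Equiv.sum_comp Fin.revPerm, ← Finset.sum_compl_add_sum {Fin.last m}]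
    simp [Fin.val_rev]
  have hle : (m + 1).choose 2 ≤ ∑ i, (m - swapLow (g i)) :=
    hw ▸ key.trans (Finset.sum_le_sum_of_subset (Finset.filter_subset _ _))
  have hadd : ∑ i, (m - swapLow (g i)) + ∑ i, swapLow (g i) = m * m := by
    rw [← Finset.sum_add_distrib, Finset.sum_congr rfl fun i _ => Nat.sub_add_cancel (hlow i)]
    simp
  have := choose_two_succ_add_choose_two m
  omega

/-- The inverse of `phiMap (m + 1) k` on minimal factorizations: unshift the factors and
insert `(0 m+1)` in position `k`. -/
noncomputable def phiInv {m k : ℕ} (hk1 : 1 ≤ k) (hkn : k ≤ m + 1)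
    (g : Fin m → Perm (Fin (m + 1))) : Fin (m + 1) → Perm (Fin (m + 2)) := fun j =>
  if h : j.val < k - 1 then liftCastSucc m (g ⟨j + (m + 1 - k), by omega⟩)
  else if h' : j.val = k - 1 then swap 0 (Fin.last (m + 1))
  else liftSucc m (g ⟨j - k, by omega⟩)

section phiInv

variable {m k : ℕ} (hk1 : 1 ≤ k) (hkn : k ≤ m + 1)

theorem ofFn_phiInv (g : Fin m → Perm (Fin (m + 1))) :
    List.ofFn (phiInv hk1 hkn g) =
      ((List.ofFn g).drop (m + 1 - k)).map (liftCastSucc m) ++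
        swap 0 (Fin.last (m + 1)) :: ((List.ofFn g).take (m + 1 - k)).map (liftSucc m) := by
  apply List.ext_getElem
  · simp; omega
  · intro i h1 h2
    simp only [List.length_ofFn] at h1
    have hlen : m - (m + 1 - k) = k - 1 := by omega
    simp only [List.getElem_ofFn, List.getElem_append, List.getElem_cons, List.getElem_map,
      List.getElem_drop, List.getElem_take, List.length_map, List.length_drop, List.length_ofFn,
      phiInv, hlen]
    split_ifs with h3 h4 h5 h5
    · congr 3; omega
    · rfl
    · omega
    · omega
    · congr 3; omega

theorem phiInv_apply_pred {hk : k - 1 < m + 1} (g : Fin m → Perm (Fin (m + 1))) :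
    phiInv hk1 hkn g ⟨k - 1, hk⟩ = swap 0 (Fin.last (m + 1)) := by
  simp [phiInv]

theorem isSwap_phiInv {g : Fin m → Perm (Fin (m + 1))} (hg : ∀ i, (g i).IsSwap)
    (j : Fin (m + 1)) : (phiInv hk1 hkn g j).IsSwap := by
  rw [phiInv]
  split_ifs with h h'
  · obtain ⟨x, y, hxy, h⟩ := hg ⟨j + (m + 1 - k), by omega⟩
    rw [h, liftCastSucc_swap]
    exact ⟨_, _, by simpa using hxy, rfl⟩
  · exact ⟨_, _, (Fin.last_pos).ne, rfl⟩
  · obtain ⟨x, y, hxy, h⟩ := hg ⟨j - k, by omega⟩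
    rw [h, liftSucc_swap]
    exact ⟨_, _, by simpa using hxy, rfl⟩

theorem prod_phiInv_eq_finRotate_iff (g : Fin m → Perm (Fin (m + 1))) :
    (List.ofFn (phiInv hk1 hkn g)).reverse.prod = finRotate (m + 2) ↔
      (List.ofFn g).reverse.prod = finRotate (m + 1) := by
  rw [ofFn_phiInv]
  conv_rhs => rw [← List.take_append_drop (m + 1 - k) (List.ofFn g)]
  rw [List.reverse_append, List.prod_append, List.reverse_append, List.prod_append,
    List.reverse_cons, List.prod_append, List.prod_singleton, ← List.map_reverse,
    ← List.map_reverse, ← map_list_prod, ← map_list_prod, liftSucc_eq_conj,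
    ← (viaEmbeddingHom_injective Fin.castSuccEmb).eq_iff (b := finRotate (m + 1))]
  change _ ↔ liftCastSucc m _ = liftCastSucc m _
  rw [map_mul, ← swap_mul_finRotate]
  generalize liftCastSucc m _ = a
  generalize liftCastSucc m _ = b
  have hτ : (swap 0 (Fin.last (m + 1)))⁻¹ = swap 0 (Fin.last (m + 1)) := swap_inv _ _
  generalize swap 0 (Fin.last (m + 1)) = τ at hτ ⊢
  generalize finRotate (m + 2) = σ
  constructor
  · intro h
    have hτ' : τ = σ * a⁻¹ * b⁻¹ := by
      calc τ = σ * a⁻¹ * σ⁻¹ * (σ * a * σ⁻¹ * τ * b) * b⁻¹ := by group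
        _ = σ * a⁻¹ * b⁻¹ := by rw [h]; group
    rw [← hτ, hτ']
    group
  · intro h
    have hτ' : τ = (b * a * σ⁻¹)⁻¹ := by rw [h, mul_inv_cancel_right, hτ]
    rw [hτ']
    group

theorem phiInv_mem_factSet_iff {g : Fin m → Perm (Fin (m + 1))} (hg : ∀ i, (g i).IsSwap) :
    phiInv hk1 hkn g ∈ FactSet (m + 1) ↔ g ∈ FactSet m :=
  ⟨fun h => ⟨hg, (prod_phiInv_eq_finRotate_iff hk1 hkn g).1 h.2⟩,
    fun h => ⟨isSwap_phiInv hk1 hkn hg, (prod_phiInv_eq_finRotate_iff hk1 hkn g).2 h.2⟩⟩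

theorem swapLow_liftCastSucc {τ : Perm (Fin (m + 1))} (h : τ.IsSwap) :
    swapLow (liftCastSucc m τ) = swapLow τ := by
  obtain ⟨x, y, hxy, rfl⟩ := exists_lt_swap h
  rw [liftCastSucc_swap, swapLow_swap (by simpa using hxy), swapLow_swap hxy, Fin.val_castSucc]

theorem swapHigh_liftCastSucc {τ : Perm (Fin (m + 1))} (h : τ.IsSwap) :
    swapHigh (liftCastSucc m τ) = swapHigh τ := by
  obtain ⟨x, y, hxy, rfl⟩ := exists_lt_swap h
  rw [liftCastSucc_swap, swapHigh_swap (by simpa using hxy), swapHigh_swap hxy, Fin.val_castSucc]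

theorem swapLow_liftSucc {τ : Perm (Fin (m + 1))} (h : τ.IsSwap) :
    swapLow (liftSucc m τ) = swapLow τ + 1 := by
  obtain ⟨x, y, hxy, rfl⟩ := exists_lt_swap h
  rw [liftSucc_swap, swapLow_swap (by simpa using hxy), swapLow_swap hxy, Fin.val_succ]

theorem swapHigh_liftSucc {τ : Perm (Fin (m + 1))} (h : τ.IsSwap) :
    swapHigh (liftSucc m τ) = swapHigh τ + 1 := by
  obtain ⟨x, y, hxy, rfl⟩ := exists_lt_swap h
  rw [liftSucc_swap, swapHigh_swap (by simpa using hxy), swapHigh_swap hxy, Fin.val_succ]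

theorem swap_swapLow_swapHigh {τ : Perm (Fin (m + 1))} (h : τ.IsSwap) (hl hh) :
    swap (⟨swapLow τ % (m + 1), hl⟩ : Fin (m + 1)) ⟨swapHigh τ % (m + 1), hh⟩ = τ := by
  obtain ⟨x, y, hxy, rfl⟩ := exists_lt_swap h
  congr 1 <;> ext
  · rw [Fin.val_mk, swapLow_swap hxy, Nat.mod_eq_of_lt x.is_lt]
  · rw [Fin.val_mk, swapHigh_swap hxy, Nat.mod_eq_of_lt y.is_lt]

theorem phiMap_phiInv {g : Fin m → Perm (Fin (m + 1))} (hg : ∀ i, (g i).IsSwap) :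
    phiMap (m + 1) k (phiInv hk1 hkn g) = g := by
  funext i
  change Fin m at i
  rw [phiMap]
  split_ifs with h
  · have hf : phiInv hk1 hkn g ⟨k + i, by omega⟩ = liftSucc m (g i) := by
      rw [phiInv, dif_neg (by simp; omega), dif_neg (by simp; omega)]
      congr 3; simp
    simp only [hf, swapLow_liftSucc (hg i), swapHigh_liftSucc (hg i), Nat.add_sub_cancel]
    exact swap_swapLow_swapHigh (hg i) _ _
  · have hf : phiInv hk1 hkn g ⟨i - (m + 1 - k), by omega⟩ = liftCastSucc m (g i) := by
      rw [phiInv, dif_pos (by simp; omega)]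
      congr 3; simp; omega
    simp only [hf, swapLow_liftCastSucc (hg i), swapHigh_liftCastSucc (hg i)]
    exact swap_swapLow_swapHigh (hg i) _ _

theorem sum_swapLow_phiInv {g : Fin m → Perm (Fin (m + 1))} (hg : ∀ i, (g i).IsSwap) :
    ∑ j, swapLow (phiInv hk1 hkn g j) = ∑ i, swapLow (g i) + (m + 1 - k) := by
  have hmem : ∀ τ ∈ List.ofFn g, τ.IsSwap := List.forall_mem_ofFn_iff.2 hg
  have h0 : swapLow (swap 0 (Fin.last (m + 1))) = 0 := swapLow_swap Fin.last_pos
  rw [← List.sum_ofFn, ← List.sum_ofFn, List.ofFn_comp', List.ofFn_comp' g, ofFn_phiInv]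
  conv_rhs => rw [← List.take_append_drop (m + 1 - k) (List.ofFn g)]
  rw [List.map_append, List.map_append, List.sum_append, List.sum_append, List.map_cons,
    List.sum_cons, h0, List.map_map, List.map_map,
    List.map_congr_left (f := swapLow ∘ liftCastSucc m) (g := swapLow)
      (fun τ hτ => swapLow_liftCastSucc (hmem τ (List.mem_of_mem_drop hτ))),
    List.map_congr_left (f := swapLow ∘ liftSucc m) (g := fun τ => swapLow τ + 1)
      (fun τ hτ => swapLow_liftSucc (hmem τ (List.mem_of_mem_take hτ))), List.sum_map_add]
  simp only [List.map_const', List.sum_replicate, List.length_take, List.length_ofFn,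
    smul_eq_mul, mul_one]
  omega

theorem sum_swapHigh_phiInv {g : Fin m → Perm (Fin (m + 1))} (hg : ∀ i, (g i).IsSwap) :
    ∑ j, swapHigh (phiInv hk1 hkn g j) =
      ∑ i, swapHigh (g i) + (m + 1 - k) + (m + 1) := by
  have hmem : ∀ τ ∈ List.ofFn g, τ.IsSwap := List.forall_mem_ofFn_iff.2 hg
  have h0 : swapHigh (swap 0 (Fin.last (m + 1))) = m + 1 := swapHigh_swap Fin.last_pos
  rw [← List.sum_ofFn, ← List.sum_ofFn, List.ofFn_comp', List.ofFn_comp' g, ofFn_phiInv]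
  conv_rhs => rw [← List.take_append_drop (m + 1 - k) (List.ofFn g)]
  rw [List.map_append, List.map_append, List.sum_append, List.sum_append, List.map_cons,
    List.sum_cons, h0, List.map_map, List.map_map,
    List.map_congr_left (f := swapHigh ∘ liftCastSucc m) (g := swapHigh)
      (fun τ hτ => swapHigh_liftCastSucc (hmem τ (List.mem_of_mem_drop hτ))),
    List.map_congr_left (f := swapHigh ∘ liftSucc m) (g := fun τ => swapHigh τ + 1)
      (fun τ hτ => swapHigh_liftSucc (hmem τ (List.mem_of_mem_take hτ))), List.sum_map_add]
  simp only [List.map_const', List.sum_replicate, List.length_take, List.length_ofFn,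
    smul_eq_mul, mul_one]
  omega

theorem areaL_phiInv {g : Fin m → Perm (Fin (m + 1))} (hg : g ∈ FactSet m) :
    areaL (phiInv hk1 hkn g) = areaL g + k - 1 := by
  have hle := sum_swapLow_le_choose_two hg
  have hc := choose_two_succ m
  rw [areaL, areaL, sum_swapLow_phiInv hk1 hkn hg.1]
  omega

theorem areaU_phiInv {g : Fin m → Perm (Fin (m + 1))} (hg : g ∈ FactSet m) :
    areaU (phiInv hk1 hkn g) = areaU g + (m + 1 - k + 1) := by
  have hle := choose_two_le_sum_swapHigh hg
  have hc := choose_two_succ m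
  rw [areaU, areaU, sum_swapHigh_phiInv hk1 hkn hg.1]
  omega

theorem exists_liftCastSucc_eq {τ : Perm (Fin (m + 2))} (hτ : τ.IsSwap)
    (h : τ (Fin.last (m + 1)) = Fin.last (m + 1)) :
    ∃ π : Perm (Fin (m + 1)), π.IsSwap ∧ τ = liftCastSucc m π := by
  obtain ⟨x, y, hxy, rfl⟩ := hτ
  have hx : Fin.last (m + 1) ≠ x := by rintro rfl; exact hxy (by simpa using h.symm)
  have hy : Fin.last (m + 1) ≠ y := by rintro rfl; exact hxy (by simpa using h)
  obtain ⟨x, rfl⟩ := Fin.exists_castSucc_eq.2 hx.symm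
  obtain ⟨y, rfl⟩ := Fin.exists_castSucc_eq.2 hy.symm
  exact ⟨swap x y, ⟨x, y, fun h => hxy (h ▸ rfl), rfl⟩, (liftCastSucc_swap x y).symm⟩

theorem exists_liftSucc_eq {τ : Perm (Fin (m + 2))} (hτ : τ.IsSwap) (h : τ 0 = 0) :
    ∃ π : Perm (Fin (m + 1)), π.IsSwap ∧ τ = liftSucc m π := by
  obtain ⟨x, y, hxy, rfl⟩ := hτ
  have hx : 0 ≠ x := by rintro rfl; exact hxy (by simpa using h.symm)
  have hy : 0 ≠ y := by rintro rfl; exact hxy (by simpa using h)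
  obtain ⟨x, rfl⟩ := Fin.exists_succ_eq.2 hx.symm
  obtain ⟨y, rfl⟩ := Fin.exists_succ_eq.2 hy.symm
  exact ⟨swap x y, ⟨x, y, fun h => hxy (h ▸ rfl), rfl⟩, (liftSucc_swap x y).symm⟩

/-- In a minimal factorization with `k`-th factor `(0 m+1)`, the later factors fix `0` and the
earlier ones fix `m + 1`. -/
theorem fixed_points_of_mem_factSet (hk1 : 1 ≤ k) {f : Fin (m + 1) → Perm (Fin (m + 2))}
    {hk : k - 1 < m + 1} (hf : f ∈ FactSet (m + 1))
    (hfk : f ⟨k - 1, hk⟩ = swap 0 (Fin.last (m + 1)))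
    (j : Fin (m + 1)) :
    (k ≤ j.val → f j 0 = 0) ∧
      (j.val < k - 1 → f j (Fin.last (m + 1)) = Fin.last (m + 1)) := by
  set A := (List.ofFn f).take (k - 1) with hA
  set B := (List.ofFn f).drop k with hB
  have hsplit : List.ofFn f = A ++ swap 0 (Fin.last (m + 1)) :: B := by
    have hlt : k - 1 < (List.ofFn f).length := by simp; omega
    conv_lhs => rw [← List.take_append_drop (k - 1) (List.ofFn f),
      List.drop_eq_getElem_cons hlt, List.getElem_ofFn, hfk, Nat.sub_add_cancel hk1]
  have hprod := hf.2
  have hswap : ∀ τ ∈ List.ofFn f, τ.IsSwap := List.forall_mem_ofFn_iff.2 hf.1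
  have key := apply_zero_of_prod_eq (m := m)
    (l := (A.reverse.map (MulAut.conj (finRotate (m + 2)))) ++ B.reverse) (by
      intro τ hτ
      rw [List.mem_append, List.mem_map, List.mem_reverse] at hτ
      rcases hτ with ⟨ρ, hρ, rfl⟩ | hτ
      · obtain ⟨x, y, hxy, rfl⟩ := hswap ρ (by
          rw [hsplit]; simp [List.mem_reverse.1 hρ])
        refine ⟨finRotate (m + 2) x, finRotate (m + 2) y, by simpa using hxy, ?_⟩
        rw [MulAut.conj_apply, mul_swap_eq_swap_mul, mul_inv_cancel_right]
      · exact hswap τ (by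
          rw [hsplit]; simp [hτ]))
    (by simp [hA, hB]; omega)
    (by
      rw [hsplit] at hprod
      simp only [List.reverse_append, List.reverse_cons, List.prod_append,
        List.prod_singleton] at hprod
      rw [List.prod_append, ← map_list_prod, ← finRotate_mul_swap, MulAut.conj_apply]
      have hτ : (swap 0 (Fin.last (m + 1)))⁻¹ = swap 0 (Fin.last (m + 1)) := swap_inv _ _
      generalize swap 0 (Fin.last (m + 1)) = τ at hτ hprod ⊢
      rw [← hprod]
      simp [mul_assoc, hτ])
  constructor
  · intro hj
    refine key _ (List.mem_append_right _ (List.mem_reverse.2 ?_))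
    rw [hB, List.mem_drop_iff_getElem]
    exact ⟨j - k, by simp only [List.length_ofFn]; omega,
      by simp only [List.getElem_ofFn, Nat.add_sub_cancel' hj]⟩
  · intro hj
    have hmem : f j ∈ A := by
      rw [hA, List.mem_take_iff_getElem]
      exact ⟨j, by simp only [List.length_ofFn]; omega, by simp only [List.getElem_ofFn]⟩
    have := key _ (List.mem_append_left _ (List.mem_map_of_mem
      (f := MulAut.conj (finRotate (m + 2))) (List.mem_reverse.2 hmem)))
    have hinv : (finRotate (m + 2))⁻¹ 0 = Fin.last (m + 1) := by
      rw [Perm.inv_eq_iff_eq, finRotate_last]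
    rw [MulAut.conj_apply, Perm.mul_apply, Perm.mul_apply, hinv] at this
    rwa [← Perm.eq_inv_iff_eq, hinv] at this

theorem exists_phiInv_eq {f : Fin (m + 1) → Perm (Fin (m + 2))}
    {hk : k - 1 < m + 1} (hf : f ∈ FactSet (m + 1))
    (hfk : f ⟨k - 1, hk⟩ = swap 0 (Fin.last (m + 1))) :
    ∃ g ∈ FactSet m, phiInv hk1 hkn g = f := by
  have hfix := fixed_points_of_mem_factSet hk1 hf hfk
  have hex : ∀ i : Fin m, ∃ π : Perm (Fin (m + 1)), π.IsSwap ∧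
      (∀ h : i.val < m + 1 - k, f ⟨k + i, by omega⟩ = liftSucc m π) ∧
      (∀ _ : ¬ i.val < m + 1 - k, f ⟨i - (m + 1 - k), by omega⟩ = liftCastSucc m π) := by
    intro i
    by_cases h : i.val < m + 1 - k
    · obtain ⟨π, hπ, h'⟩ := exists_liftSucc_eq (hf.1 ⟨k + i, by omega⟩)
        ((hfix _).1 (Nat.le_add_right k i))
      exact ⟨π, hπ, fun _ => h', fun hn => absurd h hn⟩
    · obtain ⟨π, hπ, h'⟩ := exists_liftCastSucc_eq (hf.1 ⟨i - (m + 1 - k), by omega⟩)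
        ((hfix _).2 (by simp; omega))
      exact ⟨π, hπ, fun hn => absurd hn h, fun _ => h'⟩
  choose g hg hgS hgC using hex
  have heq : phiInv hk1 hkn g = f := by
    funext j
    rw [phiInv]
    split_ifs with h h'
    · rw [← hgC _ (by simp)]
      congr 1; ext; simp
    · rw [← hfk]; congr 1; ext; exact h'.symm
    · rw [← hgS _ (by simp; omega)]
      congr 1; ext; simp; omega
  exact ⟨g, (phiInv_mem_factSet_iff hk1 hkn hg).1 (heq ▸ hf), heq⟩

end phiInv

end

/-- For `n ≥ 1` (written `n = m+1`) and `1 ≤ k ≤ n`, the map `φ_k` is a bijection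
from `Ĥ_{n,k} = {f ∈ F_n : τ_k = (0 n)}` onto `F_{n-1}`, and for every `f ∈ Ĥ_{n,k}`
one has `area_L(f) = area_L(φ_k f) + k - 1` and `area_U(f) = area_U(φ_k f) + n - k + 1`. -/
theorem phiMap_bijOn_and_area (m k : ℕ) (hk1 : 1 ≤ k) (hkn : k ≤ m + 1) :
    Set.BijOn (phiMap (m+1) k)
      {f | f ∈ FactSet (m+1) ∧
        f ⟨k - 1, by omega⟩ = Equiv.swap 0 (Fin.last (m+1))}
      (FactSet m) ∧
    ∀ f : Fin (m+1) → Equiv.Perm (Fin (m+2)),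
      f ∈ FactSet (m+1) → f ⟨k - 1, by omega⟩ = Equiv.swap 0 (Fin.last (m+1)) →
        areaL f = areaL (phiMap (m+1) k f) + k - 1 ∧
        areaU f = areaU (phiMap (m+1) k f) + ((m + 1) - k + 1) := by
  constructor
  · refine ⟨?_, ?_, ?_⟩
    · rintro f ⟨hf, hfk⟩
      obtain ⟨g, hg, rfl⟩ := exists_phiInv_eq hk1 hkn hf hfk
      rwa [phiMap_phiInv hk1 hkn hg.1]
    · rintro f ⟨hf, hfk⟩ f' ⟨hf', hfk'⟩ h
      obtain ⟨g, hg, rfl⟩ := exists_phiInv_eq hk1 hkn hf hfk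
      obtain ⟨g', hg', rfl⟩ := exists_phiInv_eq hk1 hkn hf' hfk'
      rw [phiMap_phiInv hk1 hkn hg.1, phiMap_phiInv hk1 hkn hg'.1] at h
      rw [h]
    · intro g hg
      exact ⟨phiInv hk1 hkn g, ⟨(phiInv_mem_factSet_iff hk1 hkn hg.1).2 hg,
        phiInv_apply_pred hk1 hkn g⟩, phiMap_phiInv hk1 hkn hg.1⟩
  · intro f hf hfk
    obtain ⟨g, hg, rfl⟩ := exists_phiInv_eq hk1 hkn hf hfk
    rw [phiMap_phiInv hk1 hkn hg.1]
    exact ⟨areaL_phiInv hk1 hkn hg, areaU_phiInv hk1 hkn hg⟩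
end

section
/- Let →F_n(q,t) = ∑_{f} q^{area_L(f)} t^{area_U(f)}, the sum over increasing factorizations f ∈ F_n (those whose lower sequence L(f) is weakly increasing), with →F_0(q,t) = 1. Then for all n ≥ 1, →F_n(q,t) = ∑_{k=0}^{n−1} q^k t^{n−k} →F_k(q,t) →F_{n−k−1}(q,t); consequently →F_n(q,t) = t^n C_n(q,t) for all n ≥ 0. -/
open Finset MvPolynomial

attribute [local instance] Classical.propDecidable

/-- The `q,t`-Catalan-type polynomials: `C_0(q,t) = 1` and
`C_n(q,t) = ∑_{k=0}^{n-1} q^k t^{n-k-1} C_k(q,t) C_{n-k-1}(q,t)`. -/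
noncomputable def Cpoly : ℕ → MvPolynomial (Fin 2) ℤ
  | 0 => 1
  | n + 1 => ∑ k ∈ (Finset.range (n+1)).attach,
      MvPolynomial.X 0 ^ (k : ℕ) * MvPolynomial.X 1 ^ (n - (k : ℕ)) *
        Cpoly k * Cpoly (n - (k : ℕ))
  decreasing_by
  · exact Finset.mem_range.mp k.2
  · exact Nat.lt_succ_of_le (Nat.sub_le n k)

/-- The bivariate area enumerator of increasing factorizations (those whose lower
sequence is weakly increasing):
`→F_n(q,t) = ∑ q^{area_L f} t^{area_U f}`. -/
noncomputable def FupPoly (n : ℕ) : MvPolynomial (Fin 2) ℤ :=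
  ∑ f : {f : Fin n → Equiv.Perm (Fin (n+1)) //
      f ∈ FactSet n ∧ Monotone (lowerSeq f)},
    X 0 ^ areaL f.1 * X 1 ^ areaU f.1

/-- The left-to-right action on `ℕ` of a list of transpositions, given by their endpoints. -/
def swapsAct (l : List (ℕ × ℕ)) (x : ℕ) : ℕ :=
  l.foldl (fun y p => Equiv.swap p.1 p.2 y) x

lemma swapsAct_nil (x : ℕ) : swapsAct [] x = x := rfl

lemma swapsAct_cons (p : ℕ × ℕ) (l : List (ℕ × ℕ)) (x : ℕ) :
    swapsAct (p :: l) x = swapsAct l (Equiv.swap p.1 p.2 x) := rfl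

lemma swapsAct_append (l m : List (ℕ × ℕ)) (x : ℕ) :
    swapsAct (l ++ m) x = swapsAct m (swapsAct l x) := by
  simp [swapsAct]

lemma swapsAct_injective (l : List (ℕ × ℕ)) : Function.Injective (swapsAct l) := by
  induction l with
  | nil => exact fun _ _ h => h
  | cons p l ih => exact ih.comp (Equiv.swap p.1 p.2).injective

lemma swapsAct_swap (l : List (ℕ × ℕ)) (a b x : ℕ) :
    swapsAct l (Equiv.swap a b x) =
      Equiv.swap (swapsAct l a) (swapsAct l b) (swapsAct l x) :=
  ((swapsAct_injective l).swap_apply a b x).symm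

lemma apply_swapsAct {α : Type*} {φ : ℕ → α} {l : List (ℕ × ℕ)}
    (h : ∀ p ∈ l, φ p.1 = φ p.2) (x : ℕ) : φ (swapsAct l x) = φ x := by
  induction l generalizing x with
  | nil => rfl
  | cons p l ih =>
    rw [swapsAct_cons, ih fun q hq => h q (List.mem_cons_of_mem _ hq)]
    have := h p List.mem_cons_self
    rw [Equiv.swap_apply_def]
    split_ifs <;> simp_all

lemma swapsAct_eq_self {l : List (ℕ × ℕ)} {x : ℕ} (h : ∀ p ∈ l, p.1 ≠ x ∧ p.2 ≠ x) :
    swapsAct l x = x := by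
  have := apply_swapsAct (φ := fun y => y = x) (l := l)
    (fun p hp => by simp [h p hp]) x
  simpa using this

lemma swapsAct_le {l : List (ℕ × ℕ)} {k x : ℕ} (h : ∀ p ∈ l, p.1 ≤ k ∧ p.2 ≤ k)
    (hx : x ≤ k) : swapsAct l x ≤ k := by
  have := apply_swapsAct (φ := fun y => y ≤ k) (l := l) (fun p hp => by simp [h p hp]) x
  simpa [hx] using this

/-- Translation of both endpoints by `s`. -/
def shiftPair (s : ℕ) (p : ℕ × ℕ) : ℕ × ℕ := (p.1 + s, p.2 + s)

lemma shiftPair_injective (s : ℕ) : Function.Injective (shiftPair s) := by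
  rintro ⟨a, b⟩ ⟨c, d⟩ h
  simpa [shiftPair] using h

lemma swapsAct_map_shiftPair (s : ℕ) (l : List (ℕ × ℕ)) (x : ℕ) :
    swapsAct (l.map (shiftPair s)) (x + s) = swapsAct l x + s := by
  induction l generalizing x with
  | nil => rfl
  | cons p l ih =>
    rw [List.map_cons, swapsAct_cons, swapsAct_cons, ← ih]
    congr 1
    simp only [shiftPair, Equiv.swap_apply_def, Nat.add_right_cancel_iff]
    split_ifs <;> rfl

/-- A graph on `{0, …, n}` with fewer than `n` edges is disconnected. -/
lemma exists_potential {n : ℕ} {l : List (ℕ × ℕ)} (hl : l.length < n) :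
    ∃ φ : ℕ → ℚ, φ 0 = 0 ∧ (∃ j ≤ n, φ j ≠ 0) ∧ ∀ p ∈ l, φ p.1 = φ p.2 := by
  let ev (j : ℕ) : (Fin (n + 1) → ℚ) →ₗ[ℚ] ℚ := LinearMap.proj (Fin.ofNat (n + 1) j)
  let T : (Fin (n + 1) → ℚ) →ₗ[ℚ] ℚ × (Fin l.length → ℚ) :=
    (ev 0).prod (LinearMap.pi fun i => ev (l.get i).1 - ev (l.get i).2)
  have hker : LinearMap.ker T ≠ ⊥ := by
    apply LinearMap.ker_ne_bot_of_finrank_lt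
    simp
    omega
  obtain ⟨x, hx, hx0⟩ := Submodule.exists_mem_ne_zero_of_ne_bot hker
  have hT : T x = 0 := hx
  refine ⟨fun j => x (Fin.ofNat (n + 1) j), ?_, ?_, ?_⟩
  · exact congrArg Prod.fst hT
  · obtain ⟨j, hj⟩ := Function.ne_iff.mp hx0
    exact ⟨j, by omega, by simpa using hj⟩
  · intro p hp
    obtain ⟨i, rfl⟩ := List.get_of_mem hp
    exact sub_eq_zero.mp (congrFun (congrArg Prod.snd hT) i)

lemma filter_append_filter_of_pairwise {l : List (ℕ × ℕ)}
    (h : l.Pairwise fun p q => p.1 ≤ q.1) (k : ℕ) :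
    l.filter (fun p => decide (p.1 ≤ k)) ++ l.filter (fun p => decide (k < p.1)) = l := by
  induction l with
  | nil => rfl
  | cons p l ih =>
    rw [List.pairwise_cons] at h
    by_cases hp : p.1 ≤ k
    · simp [hp, ih h.2]
    · have h1 : l.filter (fun p => decide (p.1 ≤ k)) = [] := by
        rw [List.filter_eq_nil_iff]
        intro q hq
        have := h.1 q hq
        simp
        omega
      have h2 := ih h.2
      rw [h1, List.nil_append] at h2
      simp [hp, h1, h2, not_le.mp hp]

/-- Increasing factorizations of the cycle `(0 1 ⋯ n)` into `n` transpositions, as lists of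
pairs `(lower endpoint, upper endpoint)`. -/
structure IsIncFact (n : ℕ) (l : List (ℕ × ℕ)) : Prop where
  length_eq : l.length = n
  lt : ∀ p ∈ l, p.1 < p.2
  le : ∀ p ∈ l, p.2 ≤ n
  sorted : l.Pairwise fun p q => p.1 ≤ q.1
  act_lt : ∀ x < n, swapsAct l x = x + 1
  act_top : swapsAct l n = 0

/-- The length of a product of transpositions equal to the cycle `(0 1 ⋯ n)` is at least `n`. -/
lemma le_length_of_swapsAct {n : ℕ} {l : List (ℕ × ℕ)}
    (hact : ∀ x < n, swapsAct l x = x + 1) : n ≤ l.length := by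
  by_contra! hlt
  obtain ⟨φ, h0, ⟨j, hj, hj0⟩, hφ⟩ := exists_potential hlt
  apply hj0
  clear hj0
  induction j with
  | zero => exact h0
  | succ j ih => rw [← hact j hj, apply_swapsAct hφ, ih (by omega)]

/-- Glue factorizations of `(0 1 ⋯ k)` and of `(0 1 ⋯ n-k-1)` into one of `(0 1 ⋯ n)`. -/
def glueFact (n k : ℕ) (g h : List (ℕ × ℕ)) : List (ℕ × ℕ) :=
  g.filter (fun p => decide (p.1 ≤ 0)) ++
    (0, n) :: (g.filter (fun p => decide (0 < p.1)) ++ h.map (shiftPair (k + 1)))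

lemma glueFact_isIncFact {n k : ℕ} (hk : k < n) {g h : List (ℕ × ℕ)}
    (hg : IsIncFact k g) (hh : IsIncFact (n - k - 1) h) : IsIncFact n (glueFact n k g h) := by
  have hsplit := filter_append_filter_of_pairwise hg.sorted 0
  have hlen := congrArg List.length hsplit
  have hglen := hg.length_eq
  have hhlen := hh.length_eq
  have hact := swapsAct_append (g.filter (fun p => decide (p.1 ≤ 0)))
    (g.filter (fun p => decide (0 < p.1)))
  rw [hsplit] at hact
  have hZ : ∀ p ∈ g.filter (fun p => decide (p.1 ≤ 0)), p.1 = 0 ∧ p.2 ≤ k := fun p hp => by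
    simp only [List.mem_filter, decide_eq_true_eq] at hp
    exact ⟨by omega, hg.le p hp.1⟩
  have hR : ∀ p ∈ g.filter (fun p => decide (0 < p.1)), 0 < p.1 ∧ p.1 < p.2 ∧ p.2 ≤ k :=
    fun p hp => by
      simp only [List.mem_filter, decide_eq_true_eq] at hp
      exact ⟨by omega, hg.lt p hp.1, hg.le p hp.1⟩
  have hRs : (g.filter (fun p => decide (0 < p.1))).Pairwise fun p q => p.1 ≤ q.1 :=
    hg.sorted.filter _
  have hZs : (g.filter (fun p => decide (p.1 ≤ 0))).Pairwise fun p q => p.1 ≤ q.1 :=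
    hg.sorted.filter _
  have hH : ∀ p ∈ h.map (shiftPair (k + 1)), k < p.1 ∧ p.1 < p.2 ∧ p.2 ≤ n := fun p hp => by
    obtain ⟨q, hq, rfl⟩ := List.mem_map.mp hp
    have h1 := hh.lt q hq
    have h2 := hh.le q hq
    simp only [shiftPair]
    omega
  have hHs : (h.map (shiftPair (k + 1))).Pairwise fun p q => p.1 ≤ q.1 := by
    rw [List.pairwise_map]
    exact hh.sorted.imp fun h => by simpa [shiftPair] using h
  have hHact := swapsAct_map_shiftPair (k + 1) h
  have hHlen : (h.map (shiftPair (k + 1))).length = n - k - 1 := by simpa using hhlen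
  unfold glueFact
  generalize g.filter (fun p => decide (p.1 ≤ 0)) = Z at *
  generalize g.filter (fun p => decide (0 < p.1)) = R at *
  generalize h.map (shiftPair (k + 1)) = H at *
  have hgact (x : ℕ) : swapsAct (Z ++ (0, n) :: (R ++ H)) x =
      swapsAct H (swapsAct R (Equiv.swap 0 n (swapsAct Z x))) := by
    rw [swapsAct_append, swapsAct_cons, swapsAct_append]
  have hR0 : swapsAct R 0 = 0 := swapsAct_eq_self fun p hp => by have := hR p hp; omega
  have hH0 : swapsAct H 0 = 0 := swapsAct_eq_self fun p hp => by have := hH p hp; omega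
  have hfixZ (x : ℕ) (hx : k < x) : swapsAct Z x = x :=
    swapsAct_eq_self fun p hp => by have := hZ p hp; omega
  have hfixR (x : ℕ) (hx : k < x) : swapsAct R x = x :=
    swapsAct_eq_self fun p hp => by have := hR p hp; omega
  have hfixH (x : ℕ) (hx : x ≤ k) : swapsAct H x = x :=
    swapsAct_eq_self fun p hp => by have := hH p hp; omega
  constructor
  · simp only [List.length_append, List.length_cons] at *
    omega
  · intro p hp
    simp only [List.mem_append, List.mem_cons] at hp
    rcases hp with hp | rfl | hp | hp
    · apply hg.lt p
      rw [← hsplit]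
      simp [hp]
    · simp only; omega
    · exact (hR p hp).2.1
    · exact (hH p hp).2.1
  · intro p hp
    simp only [List.mem_append, List.mem_cons] at hp
    rcases hp with hp | rfl | hp | hp
    · have := hZ p hp; omega
    · exact le_rfl
    · have := hR p hp; omega
    · exact (hH p hp).2.2
  · simp only [List.pairwise_append, List.pairwise_cons, List.mem_append, List.mem_cons]
    refine ⟨hZs, ⟨fun _ _ => Nat.zero_le _, hRs, hHs, fun p hp q hq => ?_⟩, fun p hp q _ => ?_⟩
    · have := hR p hp
      have := hH q hq
      omega
    · have := hZ p hp
      omega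
  · intro x hx
    rw [hgact]
    rcases lt_trichotomy x k with hxk | rfl | hxk
    · have h1 := hg.act_lt x hxk
      rw [hact] at h1
      have h2 : swapsAct Z x ≠ 0 := fun h => by rw [h, hR0] at h1; omega
      have h3 : swapsAct Z x ≤ k :=
        swapsAct_le (fun p hp => by have := hZ p hp; omega) hxk.le
      rw [Equiv.swap_apply_of_ne_of_ne h2 (by omega), h1, hfixH _ hxk]
    · have h1 := hg.act_top
      rw [hact] at h1
      have h2 : swapsAct Z x = 0 := swapsAct_injective R (h1.trans hR0.symm)
      rw [h2, Equiv.swap_apply_left, hfixR n hk]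
      have := hHact (n - x - 1)
      rw [hh.act_top, show n - x - 1 + (x + 1) = n by omega] at this
      omega
    · rw [hfixZ x hxk, Equiv.swap_apply_of_ne_of_ne (by omega) (by omega), hfixR x hxk]
      have := hHact (x - k - 1)
      rw [hh.act_lt _ (by omega), show x - k - 1 + (k + 1) = x by omega] at this
      omega
  · rw [hgact, hfixZ n hk, Equiv.swap_apply_right, hR0, hH0]

lemma filter_glueFact {n k : ℕ} (hk : k < n) {g h : List (ℕ × ℕ)} (hg : IsIncFact k g) :
    (glueFact n k g h).filter (fun p => decide (p.2 ≤ k)) = g := by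
  have hsplit := filter_append_filter_of_pairwise hg.sorted 0
  have h1 : g.filter (fun p => decide (p.2 ≤ k)) = g :=
    List.filter_eq_self.mpr fun p hp => by simpa using hg.le p hp
  have h2 : (h.map (shiftPair (k + 1))).filter (fun p => decide (p.2 ≤ k)) = [] := by
    rw [List.filter_eq_nil_iff]
    intro p hp
    obtain ⟨q, -, rfl⟩ := List.mem_map.mp hp
    rw [decide_eq_true_iff, shiftPair]
    omega
  rw [glueFact, List.filter_append, List.filter_cons_of_neg (by simpa using hk),
    List.filter_append, h2, List.append_nil, ← List.filter_append, hsplit, h1]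

lemma glueFact_injective {n k k' : ℕ} (hk : k < n) (hk' : k' < n) {g h g' h' : List (ℕ × ℕ)}
    (hg : IsIncFact k g) (hh : IsIncFact (n - k - 1) h)
    (hg' : IsIncFact k' g') (hh' : IsIncFact (n - k' - 1) h')
    (heq : glueFact n k g h = glueFact n k' g' h') : k = k' ∧ g = g' ∧ h = h' := by
  have key : ∀ {k : ℕ} {g h : List (ℕ × ℕ)}, k < n → IsIncFact k g → IsIncFact (n - k - 1) h →
      swapsAct ((glueFact n k g h).filter (fun p => decide (0 < p.1))) n = k + 1 := by
    intro k g h hk hg hh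
    have h1 : (g.filter (fun p => decide (p.1 ≤ 0))).filter (fun p => decide (0 < p.1)) = [] := by
      rw [List.filter_eq_nil_iff]
      intro p hp
      simp at hp
      simp [hp.2]
    have h2 : (h.map (shiftPair (k + 1))).filter (fun p => decide (0 < p.1)) =
        h.map (shiftPair (k + 1)) := by
      rw [List.filter_eq_self]
      intro p hp
      obtain ⟨q, -, rfl⟩ := List.mem_map.mp hp
      simp [shiftPair]
    rw [glueFact, List.filter_append, List.filter_cons_of_neg (by simp), List.filter_append, h1,
      h2, List.filter_filter, List.nil_append, swapsAct_append, swapsAct_eq_self (x := n)]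
    · have := swapsAct_map_shiftPair (k + 1) h (n - k - 1)
      rw [hh.act_top, show n - k - 1 + (k + 1) = n by omega] at this
      omega
    · intro p hp
      rw [List.mem_filter] at hp
      have := hg.lt p hp.1
      have := hg.le p hp.1
      omega
  obtain rfl : k = k' := by
    have h1 := key hk hg hh
    rw [heq, key hk' hg' hh'] at h1
    omega
  obtain rfl : g = g' := by rw [← filter_glueFact hk hg (h := h), heq, filter_glueFact hk hg']
  refine ⟨rfl, rfl, ?_⟩
  simp only [glueFact, List.append_cancel_left_eq, List.cons.injEq, true_and] at heq
  exact List.map_injective_iff.mpr (shiftPair_injective _) heq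

lemma exists_glueFact {n : ℕ} (hn : 1 ≤ n) {l : List (ℕ × ℕ)} (hl : IsIncFact n l) :
    ∃ k < n, ∃ g h, IsIncFact k g ∧ IsIncFact (n - k - 1) h ∧ glueFact n k g h = l := by
  have hsplit := filter_append_filter_of_pairwise hl.sorted 0
  have hZ : ∀ p ∈ l.filter (fun p => decide (p.1 ≤ 0)), p.1 = 0 := fun p hp => by
    simp only [List.mem_filter, decide_eq_true_eq] at hp
    omega
  have hR : ∀ p ∈ l.filter (fun p => decide (0 < p.1)), 0 < p.1 := fun p hp => by
    simpa using (List.mem_filter.mp hp).2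
  generalize l.filter (fun p => decide (p.1 ≤ 0)) = Z at *
  generalize l.filter (fun p => decide (0 < p.1)) = R at *
  have hlt := hl.lt
  have hle := hl.le
  have hRlt : ∀ p ∈ R, p.1 < p.2 := fun p hp => hlt p (by rw [← hsplit]; simp [hp])
  have hRle : ∀ p ∈ R, p.2 ≤ n := fun p hp => hle p (by rw [← hsplit]; simp [hp])
  have hR0 : swapsAct R 0 = 0 := swapsAct_eq_self fun p hp => by
    have := hR p hp
    have := hRlt p hp
    omega
  rcases List.eq_nil_or_concat Z with rfl | ⟨Z', ⟨a, b⟩, rfl⟩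
  · have := hl.act_lt 0 hn
    rw [← hsplit, List.nil_append, hR0] at this
    omega
  obtain rfl : a = 0 := hZ (a, b) (by simp)
  have hb0 : 0 < b := hlt (0, b) (by rw [← hsplit]; simp)
  have hbn : b ≤ n := hle (0, b) (by rw [← hsplit]; simp)
  have hsorted := hl.sorted
  have hlen := hl.length_eq
  have hZ' : ∀ p ∈ Z', p.1 = 0 ∧ p.1 < p.2 ∧ p.2 ≤ n := fun p hp =>
    ⟨hZ p (by simp [hp]), hlt p (by rw [← hsplit]; simp [hp]),
      hle p (by rw [← hsplit]; simp [hp])⟩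
  have hact (x : ℕ) : Equiv.swap 0 (swapsAct R b) (swapsAct (Z' ++ R) x) = swapsAct l x := by
    rw [← hsplit, List.concat_eq_append, List.append_assoc, swapsAct_append, swapsAct_append,
      List.singleton_append, swapsAct_cons, swapsAct_swap, hR0]
  have hlact (x : ℕ) : swapsAct l x = swapsAct R (Equiv.swap 0 b (swapsAct Z' x)) := by
    rw [← hsplit, List.concat_eq_append, List.append_assoc, swapsAct_append,
      List.singleton_append, swapsAct_cons]
  obtain ⟨k, hk⟩ : ∃ k, swapsAct R b = k + 1 := by
    apply Nat.exists_eq_succ_of_ne_zero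
    rw [← hR0, (swapsAct_injective R).ne_iff]
    omega
  have hkn : k < n := by
    have := swapsAct_le (k := n) (fun p hp => by
      have := hRlt p hp
      have := hRle p hp
      omega : ∀ p ∈ R, p.1 ≤ n ∧ p.2 ≤ n) hbn
    omega
  rw [hk] at hact
  have hact' (x : ℕ) : swapsAct (Z' ++ R) x = Equiv.swap 0 (k + 1) (swapsAct l x) := by
    rw [← hact, Equiv.swap_apply_self]
  have hact1 (x : ℕ) (hx : x < n) (hxk : x ≠ k) : swapsAct (Z' ++ R) x = x + 1 := by
    rw [hact', hl.act_lt x hx, Equiv.swap_apply_of_ne_of_ne] <;> omega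
  have hact2 : swapsAct (Z' ++ R) k = 0 := by
    rw [hact', hl.act_lt k hkn, Equiv.swap_apply_right]
  have hact3 : swapsAct (Z' ++ R) n = k + 1 := by
    rw [hact', hl.act_top, Equiv.swap_apply_left]
  have hlen' : (Z' ++ R).length + 1 = n := by
    rw [← hlen, ← hsplit]
    simp
    omega
  have hsep : ∀ p ∈ Z' ++ R, p.2 ≤ k ∨ k < p.1 := by
    obtain ⟨φ, h0, ⟨j, hj, hj0⟩, hφ⟩ := exists_potential (n := n) (l := Z' ++ R) (by omega)
    have hlow : ∀ x ≤ k, φ x = 0 := by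
      intro x hx
      induction x with
      | zero => exact h0
      | succ x ih => rw [← hact1 x (by omega) (by omega), apply_swapsAct hφ, ih (by omega)]
    have hhigh : ∀ x, k + 1 ≤ x → x ≤ n → φ x = φ (k + 1) := by
      intro x hx
      induction x, hx using Nat.le_induction with
      | base => exact fun _ => rfl
      | succ x hx ih =>
        intro hxn
        rw [← hact1 x (by omega) (by omega), apply_swapsAct hφ, ih (by omega)]
    have hne : φ (k + 1) ≠ 0 := by
      rcases le_or_gt j k with h | h
      · exact absurd (hlow j h) hj0
      · rwa [← hhigh j h hj]
    intro p hp
    by_contra! hcon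
    have hpn : p.2 ≤ n := by
      rcases List.mem_append.mp hp with hp | hp
      · exact (hZ' p hp).2.2
      · exact hRle p hp
    have := hφ p hp
    rw [hlow _ hcon.2, hhigh _ hcon.1 hpn] at this
    exact hne this.symm
  have hZk : ∀ p ∈ Z', p.2 ≤ k := fun p hp => by
    have := hsep p (by simp [hp])
    have := hZ' p hp
    omega
  have hkb : k < b := by
    by_contra! hcon
    have := apply_swapsAct (φ := fun y => y ≤ k) (l := R) (fun p hp => by
      have := hsep p (by simp [hp])
      have := hRlt p hp
      simp only [eq_iff_iff]
      omega) b
    simp [hk, hcon] at this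
  obtain rfl : b = n := by
    apply swapsAct_injective l
    rw [hl.act_top, hlact, swapsAct_eq_self (l := Z'), Equiv.swap_apply_right, hR0]
    intro p hp
    have := hZ' p hp
    have := hZk p hp
    omega
  have hRs : R.Pairwise fun p q => p.1 ≤ q.1 := by
    rw [← hsplit] at hsorted
    exact (List.pairwise_append.mp hsorted).2.1
  have hRsplit := filter_append_filter_of_pairwise hRs k
  have hR1 : ∀ p ∈ R.filter (fun p => decide (p.1 ≤ k)), 0 < p.1 ∧ p.1 < p.2 ∧ p.2 ≤ k :=
    fun p hp => by
      simp only [List.mem_filter, decide_eq_true_eq] at hp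
      have := hsep p (by simp [hp.1])
      have := hR p hp.1
      have := hRlt p hp.1
      omega
  have hH : ∀ p ∈ R.filter (fun p => decide (k < p.1)), k < p.1 ∧ p.1 < p.2 ∧ p.2 ≤ b :=
    fun p hp => by
      simp only [List.mem_filter, decide_eq_true_eq] at hp
      exact ⟨hp.2, hRlt p hp.1, hRle p hp.1⟩
  have hR1s : (R.filter (fun p => decide (p.1 ≤ k))).Pairwise fun p q => p.1 ≤ q.1 :=
    hRs.filter _
  have hHs : (R.filter (fun p => decide (k < p.1))).Pairwise fun p q => p.1 ≤ q.1 :=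
    hRs.filter _
  generalize R.filter (fun p => decide (p.1 ≤ k)) = R1 at *
  generalize R.filter (fun p => decide (k < p.1)) = H at *
  subst hRsplit
  have hg : ∀ p ∈ Z' ++ R1, p.1 < p.2 ∧ p.2 ≤ k := fun p hp => by
    rcases List.mem_append.mp hp with hp | hp
    · exact ⟨(hZ' p hp).2.1, hZk p hp⟩
    · exact (hR1 p hp).2
  have hgact (x : ℕ) (hx : x ≤ k) : swapsAct (Z' ++ R1) x = swapsAct (Z' ++ (R1 ++ H)) x := by
    rw [← List.append_assoc, swapsAct_append _ H, swapsAct_eq_self (l := H)]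
    intro p hp
    have := hH p hp
    have := swapsAct_le (fun p hp => by have := hg p hp; omega) hx (l := Z' ++ R1)
    omega
  have hHact (x : ℕ) (hx : k < x) : swapsAct H x = swapsAct (Z' ++ (R1 ++ H)) x := by
    rw [← List.append_assoc, swapsAct_append _ H, swapsAct_eq_self (l := Z' ++ R1)]
    intro p hp
    have := hg p hp
    omega
  obtain ⟨h, rfl⟩ : ∃ h : List (ℕ × ℕ), h.map (shiftPair (k + 1)) = H := by
    refine ⟨H.map fun p => (p.1 - (k + 1), p.2 - (k + 1)), ?_⟩
    rw [List.map_map]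
    refine (List.map_congr_left fun p hp => ?_).trans (List.map_id H)
    have := hH p hp
    simp only [Function.comp_apply, shiftPair, id]
    ext <;> simp only <;> omega
  have hh : ∀ p ∈ h, p.1 < p.2 ∧ p.2 ≤ b - k - 1 := fun p hp => by
    have := hH _ (List.mem_map_of_mem hp)
    simp only [shiftPair] at this
    omega
  have hhact (x : ℕ) : swapsAct h x + (k + 1) =
      swapsAct (Z' ++ (R1 ++ h.map (shiftPair (k + 1)))) (x + (k + 1)) := by
    rw [← hHact _ (by omega), swapsAct_map_shiftPair]
  have hgact1 (x : ℕ) (hx : x < k) : swapsAct (Z' ++ R1) x = x + 1 := by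
    rw [hgact x hx.le, hact1 x (by omega) (by omega)]
  have hhact1 (x : ℕ) (hx : x < b - k - 1) : swapsAct h x = x + 1 := by
    have := hhact x
    rw [hact1 _ (by omega) (by omega)] at this
    omega
  have hglen := le_length_of_swapsAct hgact1
  have hhlen := le_length_of_swapsAct hhact1
  simp only [List.length_append, List.length_map] at hlen' hglen
  refine ⟨k, hkn, Z' ++ R1, h, ⟨?_, fun p hp => (hg p hp).1, fun p hp => (hg p hp).2, ?_, hgact1,
    ?_⟩, ⟨by omega, fun p hp => (hh p hp).1, fun p hp => (hh p hp).2, ?_, hhact1, ?_⟩, ?_⟩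
  · rw [List.length_append]
    omega
  · rw [List.pairwise_append]
    refine ⟨List.pairwise_of_forall_mem_list fun p hp q hq => ?_, hR1s, fun p hp q _ => ?_⟩
    · have := hZ' p hp
      omega
    · have := hZ' p hp
      omega
  · rw [hgact k le_rfl, hact2]
  · exact (List.pairwise_map.mp hHs).imp fun h => by simpa [shiftPair] using h
  · have := hhact (b - k - 1)
    rw [show b - k - 1 + (k + 1) = b by omega, hact3] at this
    omega
  · have h1 : Z'.filter (fun p => decide (p.1 ≤ 0)) = Z' :=
      List.filter_eq_self.mpr fun p hp => by simpa using (hZ' p hp).1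
    have h2 : Z'.filter (fun p => decide (0 < p.1)) = [] :=
      List.filter_eq_nil_iff.mpr fun p hp => by simpa using (hZ' p hp).1
    have h3 : R1.filter (fun p => decide (p.1 ≤ 0)) = [] :=
      List.filter_eq_nil_iff.mpr fun p hp => by simpa using (hR1 p hp).1.ne'
    have h4 : R1.filter (fun p => decide (0 < p.1)) = R1 :=
      List.filter_eq_self.mpr fun p hp => by simpa using (hR1 p hp).1
    rw [glueFact, List.filter_append, List.filter_append, h1, h2, h3, h4, ← hsplit]
    simp

/-- Sum of the lower endpoints. -/
def lowSum (l : List (ℕ × ℕ)) : ℕ := (l.map Prod.fst).sum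

/-- Sum of the upper endpoints. -/
def highSum (l : List (ℕ × ℕ)) : ℕ := (l.map Prod.snd).sum

lemma lowSum_append (l m : List (ℕ × ℕ)) : lowSum (l ++ m) = lowSum l + lowSum m := by
  simp [lowSum]

lemma highSum_append (l m : List (ℕ × ℕ)) : highSum (l ++ m) = highSum l + highSum m := by
  simp [highSum]

lemma lowSum_map_shiftPair (s : ℕ) (l : List (ℕ × ℕ)) :
    lowSum (l.map (shiftPair s)) = lowSum l + l.length * s := by
  induction l with
  | nil => simp [lowSum]
  | cons p l ih => simp [lowSum, shiftPair] at ih ⊢; rw [ih]; ring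

lemma highSum_map_shiftPair (s : ℕ) (l : List (ℕ × ℕ)) :
    highSum (l.map (shiftPair s)) = highSum l + l.length * s := by
  induction l with
  | nil => simp [highSum]
  | cons p l ih => simp [highSum, shiftPair] at ih ⊢; rw [ih]; ring

lemma lowSum_glueFact {n k : ℕ} {g h : List (ℕ × ℕ)}
    (hg : IsIncFact k g) (hh : IsIncFact (n - k - 1) h) :
    lowSum (glueFact n k g h) = lowSum g + lowSum h + (n - k - 1) * (k + 1) := by
  have := congrArg lowSum (filter_append_filter_of_pairwise hg.sorted 0)
  rw [lowSum_append] at this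
  rw [glueFact, lowSum_append, ← List.singleton_append, lowSum_append, lowSum_append,
    lowSum_map_shiftPair, hh.length_eq, ← this]
  simp [lowSum]
  ring

lemma highSum_glueFact {n k : ℕ} {g h : List (ℕ × ℕ)}
    (hg : IsIncFact k g) (hh : IsIncFact (n - k - 1) h) :
    highSum (glueFact n k g h) = highSum g + highSum h + n + (n - k - 1) * (k + 1) := by
  have := congrArg highSum (filter_append_filter_of_pairwise hg.sorted 0)
  rw [highSum_append] at this
  rw [glueFact, highSum_append, ← List.singleton_append, highSum_append, highSum_append,
    highSum_map_shiftPair, hh.length_eq, ← this]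
  simp [highSum]
  ring

lemma choose_two_eq_of_lt {n k : ℕ} (hk : k < n) :
    n.choose 2 = k.choose 2 + (n - k - 1).choose 2 + k + (n - k - 1) * (k + 1) := by
  obtain ⟨j, rfl⟩ := Nat.exists_eq_add_of_lt hk
  rw [show k + j + 1 - k - 1 = j by omega]
  clear hk
  have hsucc (m : ℕ) : (m + 1).choose 2 = m.choose 2 + m := by
    rw [Nat.choose_succ_succ' m 1, Nat.choose_one_right, add_comm]
  induction j with
  | zero => simp [hsucc]
  | succ j ih =>
    rw [show k + (j + 1) + 1 = k + j + 1 + 1 by omega, hsucc (k + j + 1), ih, hsucc j]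
    ring

lemma IsIncFact.lowSum_le_and_le_highSum {n : ℕ} {l : List (ℕ × ℕ)} (hl : IsIncFact n l) :
    lowSum l ≤ n.choose 2 ∧ n.choose 2 ≤ highSum l := by
  induction n using Nat.strong_induction_on generalizing l with
  | _ n ih =>
    rcases Nat.eq_zero_or_pos n with rfl | hn
    · obtain rfl := List.length_eq_zero_iff.mp hl.length_eq
      simp [lowSum]
    · obtain ⟨k, hk, g, h, hg, hh, rfl⟩ := exists_glueFact hn hl
      have h1 := ih k hk hg
      have h2 := ih (n - k - 1) (by omega) hh
      rw [lowSum_glueFact hg hh, highSum_glueFact hg hh, choose_two_eq_of_lt hk]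
      omega

/-- The list of endpoint pairs of a sequence of transpositions. -/
def endpoints {n : ℕ} (f : Fin n → Equiv.Perm (Fin (n + 1))) : List (ℕ × ℕ) :=
  List.ofFn fun i => (swapLow (f i), swapHigh (f i))

lemma swapLow_swap_s17 {m : ℕ} {a b : Fin m} (h : a < b) : swapLow (Equiv.swap a b) = a := by
  rw [swapLow, Equiv.Perm.support_swap h.ne, Finset.image_insert, Finset.image_singleton,
    Finset.min_insert, Finset.min_singleton, min_eq_left (by exact_mod_cast h.le)]
  rfl

lemma swapHigh_swap_s17 {m : ℕ} {a b : Fin m} (h : a < b) : swapHigh (Equiv.swap a b) = b := by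
  rw [swapHigh, Equiv.Perm.support_swap h.ne, Finset.image_insert, Finset.image_singleton,
    Finset.max_insert, Finset.max_singleton, max_eq_right (by exact_mod_cast h.le)]
  rfl

lemma exists_lt_of_isSwap {m : ℕ} {τ : Equiv.Perm (Fin m)} (h : τ.IsSwap) :
    ∃ a b : Fin m, a < b ∧ τ = Equiv.swap a b := by
  obtain ⟨a, b, hab, rfl⟩ := h
  rcases lt_or_gt_of_ne hab with h | h
  · exact ⟨a, b, h, rfl⟩
  · exact ⟨b, a, h, Equiv.swap_comm a b⟩

lemma swapsAct_map_endpoints {m : ℕ} {L : List (Equiv.Perm (Fin m))} (h : ∀ τ ∈ L, τ.IsSwap)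
    (x : Fin m) :
    swapsAct (L.map fun τ => (swapLow τ, swapHigh τ)) x = (L.reverse.prod x : Fin m) := by
  induction L generalizing x with
  | nil => rfl
  | cons τ L ih =>
    obtain ⟨a, b, hab, hτ⟩ := exists_lt_of_isSwap (h τ List.mem_cons_self)
    rw [List.map_cons, swapsAct_cons, List.reverse_cons, List.prod_append, List.prod_singleton,
      Equiv.Perm.mul_apply, ← ih (fun σ hσ => h σ (List.mem_cons_of_mem _ hσ)), hτ,
      swapLow_swap_s17 hab, swapHigh_swap_s17 hab, Fin.val_injective.swap_apply]

lemma endpoints_eq_map {n : ℕ} (f : Fin n → Equiv.Perm (Fin (n + 1))) :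
    endpoints f = (List.ofFn f).map fun τ => (swapLow τ, swapHigh τ) := by
  rw [List.map_ofFn]
  rfl

lemma endpoints_isIncFact {n : ℕ} {f : Fin n → Equiv.Perm (Fin (n + 1))} (hf : f ∈ FactSet n)
    (hmono : Monotone (lowerSeq f)) : IsIncFact n (endpoints f) := by
  have hact (x : Fin (n + 1)) : swapsAct (endpoints f) x = (finRotate (n + 1) x : Fin (n + 1)) := by
    rw [endpoints_eq_map, swapsAct_map_endpoints, hf.2]
    simpa [List.mem_ofFn] using hf.1
  constructor
  · simp [endpoints]
  · intro p hp
    obtain ⟨i, rfl⟩ := List.mem_ofFn.mp hp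
    obtain ⟨a, b, hab, hτ⟩ := exists_lt_of_isSwap (hf.1 i)
    simpa [hτ, swapLow_swap_s17 hab, swapHigh_swap_s17 hab] using hab
  · intro p hp
    obtain ⟨i, rfl⟩ := List.mem_ofFn.mp hp
    obtain ⟨a, b, hab, hτ⟩ := exists_lt_of_isSwap (hf.1 i)
    simp only [hτ, swapHigh_swap_s17 hab]
    omega
  · rw [endpoints, List.pairwise_ofFn]
    exact fun i j hij => hmono hij.le
  · intro x hx
    have := hact ⟨x, by omega⟩
    rwa [finRotate_of_lt hx] at this
  · have := hact (Fin.last n)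
    rwa [finRotate_last] at this

lemma exists_endpoints_eq {n : ℕ} {l : List (ℕ × ℕ)} (hl : IsIncFact n l) :
    ∃ f ∈ FactSet n, Monotone (lowerSeq f) ∧ endpoints f = l := by
  obtain ⟨c, rfl⟩ : ∃ c : Fin n → ℕ × ℕ, List.ofFn c = l := by
    obtain rfl := hl.length_eq
    exact ⟨l.get, List.ofFn_get l⟩
  have hlt (i : Fin n) : (c i).1 < (c i).2 := hl.lt _ (List.mem_ofFn.mpr ⟨i, rfl⟩)
  have hle (i : Fin n) : (c i).2 ≤ n := hl.le _ (List.mem_ofFn.mpr ⟨i, rfl⟩)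
  have hsorted := hl.sorted
  rw [List.pairwise_ofFn] at hsorted
  let a (i : Fin n) : Fin (n + 1) := ⟨(c i).1, by have := hlt i; have := hle i; omega⟩
  let b (i : Fin n) : Fin (n + 1) := ⟨(c i).2, by have := hle i; omega⟩
  have hab (i : Fin n) : a i < b i := hlt i
  let f (i : Fin n) : Equiv.Perm (Fin (n + 1)) := Equiv.swap (a i) (b i)
  have hswap (i : Fin n) : (f i).IsSwap := ⟨a i, b i, (hab i).ne, rfl⟩
  have hlow (i : Fin n) : swapLow (f i) = (c i).1 := swapLow_swap_s17 (hab i)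
  have hhigh (i : Fin n) : swapHigh (f i) = (c i).2 := swapHigh_swap_s17 (hab i)
  have hend : endpoints f = List.ofFn c := by simp only [endpoints, hlow, hhigh, Prod.mk.eta]
  refine ⟨f, ⟨hswap, ?_⟩, ?_, hend⟩
  · ext x
    rw [← swapsAct_map_endpoints (by simpa [List.mem_ofFn] using hswap), ← endpoints_eq_map, hend]
    rcases Fin.eq_castSucc_or_eq_last x with ⟨y, rfl⟩ | rfl
    · rw [Fin.val_castSucc, hl.act_lt y y.2]
      simp
    · rw [finRotate_last, Fin.val_last, hl.act_top]
      rfl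
  · intro i j hij
    rcases hij.eq_or_lt with rfl | hij
    · exact le_rfl
    · simpa [lowerSeq, hlow] using hsorted hij

lemma endpoints_injOn (n : ℕ) : Set.InjOn (endpoints (n := n)) (FactSet n) := by
  intro f hf g hg h
  funext i
  have := congrFun (List.ofFn_injective h) i
  obtain ⟨a, b, hab, hfi⟩ := exists_lt_of_isSwap (hf.1 i)
  obtain ⟨c, d, hcd, hgi⟩ := exists_lt_of_isSwap (hg.1 i)
  rw [hfi, hgi, swapLow_swap_s17 hab, swapLow_swap_s17 hcd, swapHigh_swap_s17 hab, swapHigh_swap_s17 hcd,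
    Prod.mk.injEq, Fin.val_inj, Fin.val_inj] at this
  rw [hfi, hgi, this.1, this.2]

/-- The finite set of increasing factorizations of `(0 1 ⋯ n)`, as lists of endpoint pairs. -/
noncomputable def incFacts (n : ℕ) : Finset (List (ℕ × ℕ)) :=
  Finset.univ.image fun f : {f : Fin n → Equiv.Perm (Fin (n + 1)) //
    f ∈ FactSet n ∧ Monotone (lowerSeq f)} => endpoints f.1

lemma mem_incFacts {n : ℕ} {l : List (ℕ × ℕ)} : l ∈ incFacts n ↔ IsIncFact n l := by
  simp only [incFacts, Finset.mem_image, Finset.mem_univ, true_and]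
  constructor
  · rintro ⟨f, rfl⟩
    exact endpoints_isIncFact f.2.1 f.2.2
  · intro hl
    obtain ⟨f, hf, hmono, rfl⟩ := exists_endpoints_eq hl
    exact ⟨⟨f, hf, hmono⟩, rfl⟩

lemma FupPoly_eq_sum_incFacts (n : ℕ) : FupPoly n =
    ∑ l ∈ incFacts n, X 0 ^ (n.choose 2 - lowSum l) * X 1 ^ (highSum l - n.choose 2) := by
  rw [incFacts, Finset.sum_image fun f _ g _ h =>
    Subtype.ext (endpoints_injOn n f.2.1 g.2.1 h), FupPoly]
  refine Finset.sum_congr rfl fun f _ => ?_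
  simp [areaL, areaU, lowSum, highSum, endpoints, List.map_ofFn, List.sum_ofFn]

lemma FupPoly_recursion {n : ℕ} (hn : 1 ≤ n) : FupPoly n =
    ∑ k ∈ Finset.range n, X 0 ^ k * X 1 ^ (n - k) * FupPoly k * FupPoly (n - k - 1) := by
  have hprod (k : ℕ) : X 0 ^ k * X 1 ^ (n - k) * FupPoly k * FupPoly (n - k - 1) =
      ∑ x ∈ incFacts k ×ˢ incFacts (n - k - 1), X 0 ^ k * X 1 ^ (n - k) *
        (X 0 ^ (k.choose 2 - lowSum x.1) * X 1 ^ (highSum x.1 - k.choose 2) *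
          (X 0 ^ ((n - k - 1).choose 2 - lowSum x.2) *
            X 1 ^ (highSum x.2 - (n - k - 1).choose 2))) := by
    rw [mul_assoc (_ * _), FupPoly_eq_sum_incFacts, FupPoly_eq_sum_incFacts,
      Finset.sum_mul_sum, ← Finset.mul_sum, Finset.sum_product]
  rw [Finset.sum_congr rfl fun k _ => hprod k, Finset.sum_sigma', FupPoly_eq_sum_incFacts]
  symm
  refine Finset.sum_bij (fun x _ => glueFact n x.1 x.2.1 x.2.2) ?_ ?_ ?_ ?_
  · rintro ⟨k, g, h⟩ hx
    simp only [Finset.mem_sigma, Finset.mem_range, Finset.mem_product, mem_incFacts] at hx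
    exact mem_incFacts.mpr (glueFact_isIncFact hx.1 hx.2.1 hx.2.2)
  · rintro ⟨k, g, h⟩ hx ⟨k', g', h'⟩ hx' heq
    simp only [Finset.mem_sigma, Finset.mem_range, Finset.mem_product, mem_incFacts] at hx hx'
    obtain ⟨rfl, rfl, rfl⟩ :=
      glueFact_injective hx.1 hx'.1 hx.2.1 hx.2.2 hx'.2.1 hx'.2.2 heq
    rfl
  · intro l hl
    obtain ⟨k, hk, g, h, hg, hh, rfl⟩ := exists_glueFact hn (mem_incFacts.mp hl)
    exact ⟨⟨k, g, h⟩, by simp [mem_incFacts, hk, hg, hh], rfl⟩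
  · rintro ⟨k, g, h⟩ hx
    simp only [Finset.mem_sigma, Finset.mem_range, Finset.mem_product, mem_incFacts] at hx
    obtain ⟨hk, hg, hh⟩ := hx
    have h1 := hg.lowSum_le_and_le_highSum
    have h2 := hh.lowSum_le_and_le_highSum
    have h3 := choose_two_eq_of_lt hk
    simp only
    rw [lowSum_glueFact hg hh, highSum_glueFact hg hh,
      show n.choose 2 - (lowSum g + lowSum h + (n - k - 1) * (k + 1)) =
        k + (k.choose 2 - lowSum g) + ((n - k - 1).choose 2 - lowSum h) by omega,
      show highSum g + highSum h + n + (n - k - 1) * (k + 1) - n.choose 2 =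
        (n - k) + (highSum g - k.choose 2) + (highSum h - (n - k - 1).choose 2) by omega]
    ring

lemma Cpoly_succ (n : ℕ) : Cpoly (n + 1) =
    ∑ k ∈ Finset.range (n + 1), X 0 ^ k * X 1 ^ (n - k) * Cpoly k * Cpoly (n - k) := by
  rw [Cpoly]
  exact Finset.sum_attach _ fun k : ℕ => X 0 ^ k * X 1 ^ (n - k) * Cpoly k * Cpoly (n - k)

lemma FupPoly_zero : FupPoly 0 = 1 := by
  have h : incFacts 0 = {[]} := by
    ext l
    rw [mem_incFacts, Finset.mem_singleton]
    constructor
    · exact fun hl => List.length_eq_zero_iff.mp hl.length_eq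
    · rintro rfl
      constructor <;> simp [swapsAct]
  simp [FupPoly_eq_sum_incFacts, h, highSum]

lemma FupPoly_eq_X_pow_mul_Cpoly (n : ℕ) : FupPoly n = X 1 ^ n * Cpoly n := by
  induction n using Nat.strong_induction_on with
  | _ n ih =>
    cases n with
    | zero => rw [FupPoly_zero, Cpoly, pow_zero, mul_one]
    | succ n =>
      rw [FupPoly_recursion n.succ_pos, Cpoly_succ, Finset.mul_sum]
      refine Finset.sum_congr rfl fun k hk => ?_
      have hk' : k ≤ n := Nat.lt_succ_iff.mp (Finset.mem_range.mp hk)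
      rw [ih k (by omega), ih (n + 1 - k - 1) (by omega), show n + 1 - k - 1 = n - k by omega]
      obtain ⟨j, rfl⟩ := Nat.exists_eq_add_of_le hk'
      rw [show k + j + 1 - k = j + 1 by omega, show k + j - k = j by omega]
      ring

/-- For all `n ≥ 1`,
`→F_n(q,t) = ∑_{k=0}^{n-1} q^k t^{n-k} →F_k(q,t) →F_{n-k-1}(q,t)`; consequently
`→F_n(q,t) = tⁿ C_n(q,t)` for all `n ≥ 0`. -/
theorem FupPoly_recursion_and_eq_Cpoly :
    (∀ n : ℕ, 1 ≤ n → FupPoly n =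
      ∑ k ∈ Finset.range n, X 0 ^ k * X 1 ^ (n - k) * FupPoly k * FupPoly (n - k - 1)) ∧
    (∀ n : ℕ, FupPoly n = X 1 ^ n * Cpoly n) := by
  exact ⟨fun _ hn => FupPoly_recursion hn, FupPoly_eq_X_pow_mul_Cpoly⟩
end
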